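/- For each integer n ≥ 1 there is a ring homomorphism e_n : Λ → ℤ[s^{±1}] determined by e_n(λ) = s^{2n−1}, e_n(z) = s − s^{-1}, and e_n(δ) = 1 − (s^{2n−2} + s^{2n−4} + ⋯ + s^{2−2n}) (the unique value with s^{1−2n} − s^{2n−1} = (s − s^{-1})(e_n(δ) − 1)). Moreover, these homomorphisms separate points: for every nonzero a ∈ Λ there exists n ≥ 1 with e_n(a) ≠ 0. -/

import Mathlib

noncomputable section

open MvPolynomial

/-- Polynomial ring ℤ[l, linv, z, d] with variables 0 = λ, 1 = λ⁻¹, 2 = z, 3 = δ. -/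
abbrev LambdaPoly : Type := MvPolynomial (Fin 4) ℤ

/-- The ideal ⟨λ·λ⁻¹ − 1, λ⁻¹ − λ − z(δ − 1)⟩. -/
def lambdaIdeal : Ideal LambdaPoly :=
  Ideal.span {X 0 * X 1 - 1, X 1 - X 0 - X 2 * (X 3 - 1)}

/-- The coefficient ring Λ = ℤ[λ^{±1}, z, δ]/⟨λ⁻¹ − λ − z(δ−1)⟩. -/
abbrev Lambda : Type := LambdaPoly ⧸ lambdaIdeal

def lam : Lambda := Ideal.Quotient.mk lambdaIdeal (X 0)
def lamInv : Lambda := Ideal.Quotient.mk lambdaIdeal (X 1)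
def zz : Lambda := Ideal.Quotient.mk lambdaIdeal (X 2)
def del : Lambda := Ideal.Quotient.mk lambdaIdeal (X 3)

open LaurentPolynomial in
lemma geomT (c : ℤ) (k : ℕ) :
    (T 1 - T (-1) : LaurentPolynomial ℤ) * ∑ j ∈ Finset.range k, T (c - 2 * (j:ℤ))
      = T (c + 1) - T (c + 1 - 2 * (k:ℤ)) := by
  induction k with
  | zero => simp
  | succ k ih =>
    rw [Finset.sum_range_succ, mul_add, ih, sub_mul, ← T_add, ← T_add]
    have h1 : (1 : ℤ) + (c - 2 * (k:ℤ)) = c + 1 - 2 * (k:ℤ) := by ring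
    have h2 : (-1 : ℤ) + (c - 2 * (k:ℤ)) = c + 1 - 2 * ((k + 1 : ℕ):ℤ) := by push_cast; ring
    rw [h1, h2]; ring

lemma rel1 : lam * lamInv = 1 := by
  have : Ideal.Quotient.mk lambdaIdeal (X 0 * X 1 - 1) = 0 :=
    Ideal.Quotient.eq_zero_iff_mem.2 (Ideal.subset_span (by simp))
  rw [map_sub, map_mul, map_one] at this
  exact sub_eq_zero.1 this

lemma rel2 : lamInv - lam = zz * (del - 1) := by
  have : Ideal.Quotient.mk lambdaIdeal (X 1 - X 0 - X 2 * (X 3 - 1)) = 0 :=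
    Ideal.Quotient.eq_zero_iff_mem.2 (Ideal.subset_span (by simp))
  rw [map_sub, map_sub, map_mul, map_sub, map_one] at this
  exact sub_eq_zero.1 this

/-- evaluation of a polynomial in z (inner) and w (outer) -/
def ev2 {R : Type} [CommRing R] (z w : R) : Polynomial (Polynomial ℤ) →+* R :=
  Polynomial.eval₂RingHom (Polynomial.eval₂RingHom (Int.castRingHom R) z) w

lemma ev2_map {R S : Type} [CommRing R] [CommRing S] (g : R →+* S) (z w : R)
    (p : Polynomial (Polynomial ℤ)) : g (ev2 z w p) = ev2 (g z) (g w) p := by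
  have : g.comp (ev2 z w) = ev2 (g z) (g w) := by
    apply Polynomial.ringHom_ext'
    · apply Polynomial.ringHom_ext'
      · exact RingHom.ext_int _ _
      · simp [ev2]
    · simp [ev2]
  exact congrArg (fun f => f p) this

lemma normal_form (a : Lambda) : ∃ A B : Polynomial (Polynomial ℤ),
    a = ev2 zz (del - 1) A + ev2 zz (del - 1) B * lam := by
  obtain ⟨p, rfl⟩ := Ideal.Quotient.mk_surjective a
  have hw : ev2 zz (del - 1) Polynomial.X = del - 1 := by simp [ev2]
  have hz : ev2 zz (del - 1) (Polynomial.C Polynomial.X) = zz := by simp [ev2]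
  have r1 := rel1
  have r2 := rel2
  induction p using MvPolynomial.induction_on with
  | C r =>
    refine ⟨(r : Polynomial (Polynomial ℤ)), 0, ?_⟩
    simp
  | add p q hp hq =>
    obtain ⟨A, B, h⟩ := hp
    obtain ⟨A', B', h'⟩ := hq
    refine ⟨A + A', B + B', ?_⟩
    rw [map_add, h, h', map_add, map_add]; ring
  | mul_X p i hp =>
    obtain ⟨A, B, h⟩ := hp
    rw [map_mul, h]
    generalize hφ : ev2 zz (del - 1) = φ at *
    fin_cases i
    · refine ⟨B, A - Polynomial.C Polynomial.X * Polynomial.X * B, ?_⟩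
      change _ * lam = _
      rw [map_sub, map_mul, map_mul, hw, hz]
      linear_combination φ B * r1 - φ B * lam * r2
    · refine ⟨A * (Polynomial.C Polynomial.X * Polynomial.X) + B, A, ?_⟩
      change _ * lamInv = _
      rw [map_add, map_mul, map_mul, hw, hz]
      linear_combination φ B * r1 + φ A * r2
    · refine ⟨A * Polynomial.C Polynomial.X, B * Polynomial.C Polynomial.X, ?_⟩
      change _ * zz = _
      rw [map_mul, map_mul, hz]; ring
    · refine ⟨A * (Polynomial.X + 1), B * (Polynomial.X + 1), ?_⟩
      change _ * del = _
      rw [map_mul, map_mul, map_add, hw, map_one]; ring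

lemma inj_aux {a b : ℝ} (ha : 0 < a) (hb : 0 < b) (h : a⁻¹ - a = b⁻¹ - b) : a = b := by
  field_simp at h
  have : (a - b) * (a * b + 1) = 0 := by linear_combination -h
  rcases mul_eq_zero.1 this with h | h
  · linarith
  · nlinarith [mul_pos ha hb]

/-- vanishing at enough points -/
lemma ev2_zero (B : Polynomial (Polynomial ℤ))
    (h : ∀ k n : ℕ, ∃ w : ℝ, (((k:ℝ)+2) - ((k:ℝ)+2)⁻¹) * w
        = (((k:ℝ)+2)^(2*n+1))⁻¹ - ((k:ℝ)+2)^(2*n+1) ∧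
      ev2 (((k:ℝ)+2) - ((k:ℝ)+2)⁻¹) w B = 0) : B = 0 := by
  choose w hw hB using h
  ext1 i
  rw [Polynomial.coeff_zero]
  have hinjZ : Function.Injective (Int.castRingHom ℝ) := Int.cast_injective
  rw [← Polynomial.map_eq_zero_iff hinjZ]
  apply Polynomial.eq_zero_of_infinite_isRoot
  apply (Set.infinite_range_of_injective
    (f := fun k : ℕ => (((k:ℝ)+2) - ((k:ℝ)+2)⁻¹)) ?_).mono
  · rintro _ ⟨k, rfl⟩
    have hk : (0:ℝ) ≤ k := Nat.cast_nonneg k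
    have hw' := hw k
    have hB' := hB k
    simp only [Set.mem_ofPred_eq, Polynomial.IsRoot.def, Polynomial.eval_map]
    have hx : (1:ℝ) < (k:ℝ) + 2 := by linarith
    generalize (k:ℝ) + 2 = x at *
    have key : B.map (Polynomial.eval₂RingHom (Int.castRingHom ℝ) (x - x⁻¹)) = 0 := by
      apply Polynomial.eq_zero_of_infinite_isRoot
      apply (Set.infinite_range_of_injective (f := w k) ?_).mono
      · rintro _ ⟨n, rfl⟩
        simp only [Set.mem_ofPred_eq, Polynomial.IsRoot.def, Polynomial.eval_map]
        exact hB' n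
      · intro n m hnm
        have h1 := hw' n
        rw [hnm, hw' m] at h1
        have h2 := inj_aux (by positivity) (by positivity) h1
        have := (pow_right_injective₀ (by linarith) hx.ne') h2
        omega
    have := congrArg (fun p => Polynomial.coeff p i) key
    simpa using this
  · intro k m hkm
    have hkm : ((k:ℝ)+2) - ((k:ℝ)+2)⁻¹ = ((m:ℝ)+2) - ((m:ℝ)+2)⁻¹ := hkm
    have := inj_aux (a := (k:ℝ)+2) (b := (m:ℝ)+2) (by positivity) (by positivity) (by linarith)
    have : (k:ℝ) = m := by linarith
    exact_mod_cast this

/-- evaluation of Laurent polynomials -/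
lemma laurentEval (x : ℝ) (hx : x ≠ 0) :
    ∃ g : LaurentPolynomial ℤ →+* ℝ, ∀ n : ℤ, g (LaurentPolynomial.T n) = x ^ n := by
  refine ⟨LaurentPolynomial.eval₂ (Int.castRingHom ℝ) (Units.mk0 x hx), fun n => ?_⟩
  simp

lemma exists_hom (n : ℕ) (hn : 1 ≤ n) : ∃ f : Lambda →+* LaurentPolynomial ℤ,
        f lam = LaurentPolynomial.T (2*(n:ℤ) - 1) ∧
        f lamInv = LaurentPolynomial.T (1 - 2*(n:ℤ)) ∧
        f zz = LaurentPolynomial.T 1 - LaurentPolynomial.T (-1) ∧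
        f del = 1 - ∑ j ∈ Finset.range (2*n - 1),
          LaurentPolynomial.T (2*(n:ℤ) - 2 - 2*(j:ℤ)) := by
  have hg := geomT (2*(n:ℤ) - 2) (2*n-1)
  have e1 : 2*(n:ℤ) - 2 + 1 = 2 * n - 1 := by ring
  have e2 : 2*(n:ℤ) - 1 - 2 * ((2*n-1 : ℕ) : ℤ) = 1 - 2 * n := by
    push_cast [Nat.cast_sub (show 1 ≤ 2 * n by omega)]; ring
  rw [e1, e2] at hg
  let v : Fin 4 → LaurentPolynomial ℤ := ![LaurentPolynomial.T (2*(n:ℤ) - 1),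
    LaurentPolynomial.T (1 - 2*(n:ℤ)), LaurentPolynomial.T 1 - LaurentPolynomial.T (-1),
    1 - ∑ j ∈ Finset.range (2*n - 1), LaurentPolynomial.T (2*(n:ℤ) - 2 - 2*(j:ℤ))]
  let φ : LambdaPoly →+* LaurentPolynomial ℤ := eval₂Hom (Int.castRingHom _) v
  have hX : ∀ i, φ (X i) = v i := fun i => by simp [φ]
  have hφ : ∀ a ∈ lambdaIdeal, φ a = 0 := by
    intro a ha
    have : lambdaIdeal ≤ RingHom.ker φ := by
      apply Ideal.span_le.2
      rintro _ (rfl | rfl)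
      · simp only [SetLike.mem_coe, RingHom.mem_ker, map_sub, map_mul, map_one, hX]
        simp only [v, Matrix.cons_val]
        rw [← LaurentPolynomial.T_add, show 2*(n:ℤ) - 1 + (1 - 2 * n) = 0 by ring,
          LaurentPolynomial.T_zero, sub_self]
      · simp only [SetLike.mem_coe, RingHom.mem_ker, map_sub, map_mul, map_one, hX]
        simp only [v, Matrix.cons_val]
        linear_combination hg
    exact this ha
  exact ⟨Ideal.Quotient.lift lambdaIdeal φ hφ, hX 0, hX 1, hX 2, hX 3⟩

/-- for each n ≥ 1 there is a ring homomorphism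
e_n : Λ → ℤ[s^{±1}] with e_n(λ) = s^{2n−1}, e_n(z) = s − s⁻¹ and
e_n(δ) = 1 − (s^{2n−2} + s^{2n−4} + ⋯ + s^{2−2n}), and these homomorphisms
separate points: for every nonzero a ∈ Λ there is n ≥ 1 with e_n(a) ≠ 0. -/
theorem statement10 :
    ∃ F : ℕ → (Lambda →+* LaurentPolynomial ℤ),
      (∀ n : ℕ, 1 ≤ n →
        F n lam = LaurentPolynomial.T (2*(n:ℤ) - 1) ∧
        F n lamInv = LaurentPolynomial.T (1 - 2*(n:ℤ)) ∧
        F n zz = LaurentPolynomial.T 1 - LaurentPolynomial.T (-1) ∧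
        F n del = 1 - ∑ j ∈ Finset.range (2*n - 1),
          LaurentPolynomial.T (2*(n:ℤ) - 2 - 2*(j:ℤ))) ∧
      (∀ a : Lambda, a ≠ 0 → ∃ n : ℕ, 1 ≤ n ∧ F n a ≠ 0) := by
  have H : ∀ n : ℕ, ∃ f : Lambda →+* LaurentPolynomial ℤ, 1 ≤ n →
        f lam = LaurentPolynomial.T (2*(n:ℤ) - 1) ∧
        f lamInv = LaurentPolynomial.T (1 - 2*(n:ℤ)) ∧
        f zz = LaurentPolynomial.T 1 - LaurentPolynomial.T (-1) ∧
        f del = 1 - ∑ j ∈ Finset.range (2*n - 1),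
          LaurentPolynomial.T (2*(n:ℤ) - 2 - 2*(j:ℤ)) := by
    intro n
    by_cases hn : 1 ≤ n
    · obtain ⟨f, hf⟩ := exists_hom n hn
      exact ⟨f, fun _ => hf⟩
    · obtain ⟨f, hf⟩ := exists_hom 1 le_rfl
      exact ⟨f, fun h => absurd h hn⟩
  choose F hF using H
  refine ⟨F, hF, fun a ha => ?_⟩
  by_contra! hcon
  apply ha
  obtain ⟨A, B, rfl⟩ := normal_form a
  have main : ∀ k n : ℕ, ∃ w : ℝ, (((k:ℝ)+2) - ((k:ℝ)+2)⁻¹) * w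
        = (((k:ℝ)+2)^(2*n+1))⁻¹ - ((k:ℝ)+2)^(2*n+1) ∧
      ev2 (((k:ℝ)+2) - ((k:ℝ)+2)⁻¹) w A = 0 ∧ ev2 (((k:ℝ)+2) - ((k:ℝ)+2)⁻¹) w B = 0 := by
    intro k n
    have hx : (1:ℝ) < (k:ℝ) + 2 := by
      have : (0:ℝ) ≤ k := Nat.cast_nonneg k
      linarith
    generalize (k:ℝ) + 2 = x at *
    have hx0 : x ≠ 0 := by linarith
    have h0 := hcon (n+1) (by omega)
    obtain ⟨f1, f2, f3, -⟩ := hF (n+1) (by omega)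
    have e1 : 2 * ((n+1 : ℕ) : ℤ) - 1 = ((2*n+1 : ℕ) : ℤ) := by push_cast; ring
    have e2 : 1 - 2 * ((n+1 : ℕ) : ℤ) = -((2*n+1 : ℕ) : ℤ) := by push_cast; ring
    rw [e1] at f1
    rw [e2] at f2
    have P : ∀ y : ℝ, y ≠ 0 → ∃ w : ℝ, (y - y⁻¹) * w = (y^(2*n+1))⁻¹ - y^(2*n+1) ∧
        ev2 (y - y⁻¹) w A + ev2 (y - y⁻¹) w B * y^(2*n+1) = 0 := by
      intro y hy
      obtain ⟨g, hg⟩ := laurentEval y hy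
      let G : Lambda →+* ℝ := g.comp (F (n+1))
      have g1 : G lam = y^(2*n+1) := by
        simp only [G, RingHom.comp_apply, f1, hg, zpow_natCast]
      have g2 : G lamInv = (y^(2*n+1))⁻¹ := by
        simp only [G, RingHom.comp_apply, f2, hg, zpow_neg, zpow_natCast]
      have g3 : G zz = y - y⁻¹ := by
        simp only [G, RingHom.comp_apply, f3, map_sub, hg, zpow_neg, zpow_one]
      refine ⟨G (del - 1), ?_, ?_⟩
      · rw [← g3, ← map_mul, ← rel2, map_sub, g1, g2]
      · have : G (ev2 zz (del - 1) A + ev2 zz (del - 1) B * lam) = 0 := by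
          simp only [G, RingHom.comp_apply, h0, map_zero]
        rw [map_add, map_mul, ev2_map, ev2_map, g1, g3] at this
        exact this
    obtain ⟨w, hw, hAB⟩ := P x hx0
    obtain ⟨w', hw', hAB'⟩ := P (-x⁻¹) (by simpa using hx0)
    have ez : -x⁻¹ - (-x⁻¹)⁻¹ = x - x⁻¹ := by rw [inv_neg, inv_inv]; ring
    have eL : (-x⁻¹)^(2*n+1) = -(x^(2*n+1))⁻¹ := by
      rw [Odd.neg_pow ⟨n, rfl⟩, inv_pow]
    rw [ez, eL] at hw' hAB'
    have hz : x - x⁻¹ ≠ 0 := by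
      have : x⁻¹ < 1 := inv_lt_one_of_one_lt₀ hx
      linarith
    have hww : w' = w := by
      apply mul_left_cancel₀ hz
      rw [hw, hw', inv_neg, inv_inv]; ring
    rw [hww] at hAB'
    have hL : 0 < x^(2*n+1) := by positivity
    have hL' : 0 < (x^(2*n+1))⁻¹ := by positivity
    have hB : ev2 (x - x⁻¹) w B = 0 := by
      have : ev2 (x - x⁻¹) w B * (x^(2*n+1) + (x^(2*n+1))⁻¹) = 0 := by
        linear_combination hAB - hAB'
      rcases mul_eq_zero.1 this with h | h
      · exact h
      · linarith
    refine ⟨w, hw, ?_, hB⟩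
    rw [hB] at hAB
    linarith
  have hA : A = 0 := ev2_zero A fun k n => by
    obtain ⟨w, h1, h2, h3⟩ := main k n
    exact ⟨w, h1, h2⟩
  have hB : B = 0 := ev2_zero B fun k n => by
    obtain ⟨w, h1, h2, h3⟩ := main k n
    exact ⟨w, h1, h3⟩
  rw [hA, hB, map_zero, zero_mul, add_zero]
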